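/- Let 𝔽 be ℝ or ℂ, let k ≥ 3 be an integer, and let Φ : M₂(𝔽) → M₂(𝔽) be a map whose range contains every rank-one matrix and which satisfies [Φ(A), Φ(B)]_k = [A, B]_k for all A, B ∈ M₂(𝔽). Then for every A ∈ M₂(𝔽), Φ(A) can be written as λ·I + N for some λ ∈ 𝔽 and some N ∈ M₂(𝔽) with N² = 0 if and only if A can be written as μ·I + M for some μ ∈ 𝔽 and some M ∈ M₂(𝔽) with M² = 0. -/

import Mathlib

/-- The k-commutator: `kComm 0 A B = A`, `kComm (k+1) A B = [kComm k A B, B]`. -/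
def kComm {𝔽 : Type*} [Field 𝔽] : ℕ → Matrix (Fin 2) (Fin 2) 𝔽 → Matrix (Fin 2) (Fin 2) 𝔽 → Matrix (Fin 2) (Fin 2) 𝔽
  | 0, A, _ => A
  | n + 1, A, B => kComm n A B * B - B * kComm n A B

open Matrix in
theorem exists_smul_one_add_sq_zero_iff {𝔽 : Type*} [Field 𝔽] [NeZero (2 : 𝔽)]
    (A : Matrix (Fin 2) (Fin 2) 𝔽) :
    (∃ (c : 𝔽) (N : Matrix (Fin 2) (Fin 2) 𝔽), N * N = 0 ∧ A = c • 1 + N) ↔ A.discr = 0 := by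
  have h2 : (2 : 𝔽) ≠ 0 := NeZero.ne _
  simp only [discr_fin_two, trace_fin_two, det_fin_two]
  constructor
  · rintro ⟨c, N, hN, rfl⟩
    have h00 := congrFun₂ hN 0 0
    have h01 := congrFun₂ hN 0 1
    have h10 := congrFun₂ hN 1 0
    have h11 := congrFun₂ hN 1 1
    simp [mul_apply, Fin.sum_univ_two] at h00 h01 h10 h11 ⊢
    have ht : N 0 0 + N 1 1 = 0 ∨ N 0 1 = 0 := by
      rw [← mul_eq_zero]; linear_combination h01
    rcases ht with ht | ht
    · linear_combination (N 0 0 + N 1 1 - 4 * N 1 1) * ht + 4 * h11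
    · have hp : N 0 0 = 0 := by simpa [ht] using h00
      have hq : N 1 1 = 0 := by simpa [ht] using h11
      rw [ht, hp, hq]; ring
  · intro h
    refine ⟨(A 0 0 + A 1 1) / 2, A - ((A 0 0 + A 1 1) / 2) • 1, ?_, by simp⟩
    ext i j
    fin_cases i <;> fin_cases j <;> simp [mul_apply, Fin.sum_univ_two] <;> field_simp
    · linear_combination h
    · ring
    · ring
    · linear_combination h

theorem kComm_add_three {𝔽 : Type*} [Field 𝔽] (n : ℕ) (A B : Matrix (Fin 2) (Fin 2) 𝔽) :
    kComm (n + 3) A B = B.discr • kComm (n + 1) A B := by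
  simp only [kComm]
  generalize kComm n A B = X
  ext i j
  fin_cases i <;> fin_cases j <;>
    simp [Matrix.mul_apply, Fin.sum_univ_two, Matrix.discr_fin_two, Matrix.trace_fin_two,
      Matrix.det_fin_two] <;> ring

theorem commute_of_kComm_eq_zero {𝔽 : Type*} [Field 𝔽] {A B : Matrix (Fin 2) (Fin 2) 𝔽}
    (hB : B.discr ≠ 0) {n : ℕ} (h : kComm (n + 1) A B = 0) : Commute A B := by
  induction n with
  | zero => exact sub_eq_zero.mp h
  | succ n ih =>
    have h' : kComm (n + 3) A B = 0 := by
      change kComm (n + 2) A B * B - B * kComm (n + 2) A B = 0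
      simp [h]
    rw [kComm_add_three] at h'
    exact ih ((smul_eq_zero.mp h').resolve_left hB)

theorem kComm_eq_zero_of_discr_eq_zero {𝔽 : Type*} [Field 𝔽] {A B : Matrix (Fin 2) (Fin 2) 𝔽}
    (hB : B.discr = 0) {k : ℕ} (hk : 3 ≤ k) : kComm k A B = 0 := by
  obtain ⟨n, rfl⟩ := Nat.exists_eq_add_of_le' hk
  rw [kComm_add_three, hB, zero_smul]

theorem rank_single_one {𝔽 : Type*} [Field 𝔽] (i j : Fin 2) :
    (Matrix.single i j (1 : 𝔽)).rank = 1 := by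
  apply le_antisymm
  · rw [Matrix.single_eq_single_vecMulVec_single]
    exact Matrix.rank_vecMulVec_le _ _
  · rw [Nat.one_le_iff_ne_zero, Ne, Matrix.rank, Submodule.finrank_eq_zero, LinearMap.range_eq_bot]
    intro h
    simpa using congrFun (LinearMap.congr_fun h (Pi.single j 1)) i

theorem discr_eq_zero_of_kComm_eq_zero {𝔽 : Type*} [Field 𝔽] {B : Matrix (Fin 2) (Fin 2) 𝔽}
    {k : ℕ} (hk : k ≠ 0)
    (h : ∀ T : Matrix (Fin 2) (Fin 2) 𝔽, T.rank = 1 → kComm k T B = 0) : B.discr = 0 := by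
  by_contra hB
  obtain ⟨n, rfl⟩ := Nat.exists_eq_succ_of_ne_zero hk
  have hc (i j : Fin 2) := (commute_of_kComm_eq_zero hB (h _ (rank_single_one i j))).eq
  have h1 := congrFun₂ (hc 0 0) 0 1
  have h2 := congrFun₂ (hc 0 1) 0 1
  simp [Matrix.mul_apply, Matrix.single_apply] at h1 h2
  apply hB
  rw [Matrix.discr_fin_two, Matrix.trace_fin_two, Matrix.det_fin_two, h1, h2]
  ring

theorem phi_preserves_scalar_plus_nilpotent {𝔽 : Type*} [RCLike 𝔽] (k : ℕ) (hk : 3 ≤ k)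
    (Φ : Matrix (Fin 2) (Fin 2) 𝔽 → Matrix (Fin 2) (Fin 2) 𝔽)
    (hrange : ∀ T : Matrix (Fin 2) (Fin 2) 𝔽, T.rank = 1 → ∃ A, Φ A = T)
    (hpres : ∀ A B : Matrix (Fin 2) (Fin 2) 𝔽, kComm k (Φ A) (Φ B) = kComm k A B) :
    ∀ A : Matrix (Fin 2) (Fin 2) 𝔽,
      (∃ (lam : 𝔽) (N : Matrix (Fin 2) (Fin 2) 𝔽), N * N = 0 ∧ Φ A = lam • 1 + N) ↔
      (∃ (mu : 𝔽) (M : Matrix (Fin 2) (Fin 2) 𝔽), M * M = 0 ∧ A = mu • 1 + M) := by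
  intro A
  rw [exists_smul_one_add_sq_zero_iff, exists_smul_one_add_sq_zero_iff]
  constructor
  · intro h
    refine discr_eq_zero_of_kComm_eq_zero (k := k) (by omega) fun T _ => ?_
    rw [← hpres, kComm_eq_zero_of_discr_eq_zero h hk]
  · intro h
    refine discr_eq_zero_of_kComm_eq_zero (k := k) (by omega) fun T hT => ?_
    obtain ⟨X, rfl⟩ := hrange T hT
    rw [hpres, kComm_eq_zero_of_discr_eq_zero h hk]
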